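/- Existence and uniqueness of the controlled trajectory F(l): assume the modulus-of-continuity condition, the local integrability condition ∫₀¹ sup_{|x| ≤ R}(|b(s,x)| + ‖σ(s,x)‖²) ds < ∞ for every R > 0, the local Osgood-type condition for every R > 0, and the growth condition for |x| ≥ K. Then for every absolutely continuous l : [0,1] → ℝ^m with l(0) = 0 and ∫₀¹ |l'(t)|² dt < ∞, there exists exactly one continuous path h : [0,1] → ℝ^d satisfying h(t) = x₀ + ∫₀ᵗ b(s, h(s)) ds + ∫₀ᵗ σ(s, h(s)) l'(s) ds for all t ∈ [0,1]. -/

import Mathlib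

open MeasureTheory Set Metric
open scoped RealInnerProductSpace ENNReal

noncomputable section

/-- Matrix times vector, landing in Euclidean space. -/
def mVec {d m : ℕ} (A : Matrix (Fin d) (Fin m) ℝ)
    (v : EuclideanSpace ℝ (Fin m)) : EuclideanSpace ℝ (Fin d) :=
  (WithLp.equiv 2 (Fin d → ℝ)).symm fun i => ∑ j, A i j * v j

/-- Transposed matrix times vector (`σᵀ x`), landing in Euclidean space. -/
def mVecT {d m : ℕ} (A : Matrix (Fin d) (Fin m) ℝ)
    (x : EuclideanSpace ℝ (Fin d)) : EuclideanSpace ℝ (Fin m) :=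
  (WithLp.equiv 2 (Fin m → ℝ)).symm fun j => ∑ i, A i j * x i

/-- Square of the Frobenius (Hilbert–Schmidt) norm `‖A‖² = ∑ᵢⱼ Aᵢⱼ²`. -/
def frobSq {d m : ℕ} (A : Matrix (Fin d) (Fin m) ℝ) : ℝ :=
  ∑ i, ∑ j, (A i j) ^ 2

/-- An admissible control: `l'` is (a.e. strongly) measurable on `[0,1]` and
`∫₀¹ ‖l'(t)‖² dt < ∞`; `l'` plays the role of the derivative of an absolutely
continuous path `l` with `l(0) = 0`, so that `e(l) = ∫₀¹ ‖l'(t)‖² dt`. -/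
def Adm {m : ℕ} (l' : ℝ → EuclideanSpace ℝ (Fin m)) : Prop :=
  AEStronglyMeasurable l' (volume.restrict (Icc 0 1)) ∧
    IntegrableOn (fun t => ‖l' t‖ ^ 2) (Icc 0 1)

/-- `h` is a solution on `[0,1]` of the controlled equation
`h(t) = x₀ + ∫₀ᵗ b(s, h(s)) ds + ∫₀ᵗ σ(s, h(s)) l'(s) ds` driven by the
absolutely continuous path `l` with derivative `l'`. -/
def IsSol {d m : ℕ} (b : ℝ → EuclideanSpace ℝ (Fin d) → EuclideanSpace ℝ (Fin d))
    (σ : ℝ → EuclideanSpace ℝ (Fin d) → Matrix (Fin d) (Fin m) ℝ)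
    (x₀ : EuclideanSpace ℝ (Fin d)) (l' : ℝ → EuclideanSpace ℝ (Fin m))
    (h : ℝ → EuclideanSpace ℝ (Fin d)) : Prop :=
  ContinuousOn h (Icc 0 1) ∧ ∀ t ∈ Icc (0:ℝ) 1,
    h t = x₀ + ∫ s in (0:ℝ)..t, (b s (h s) + mVec (σ s (h s)) (l' s))



theorem AbsolutelyContinuousOnInterval.of_dist_le {X Y : Type*} [PseudoMetricSpace X]
    [PseudoMetricSpace Y] {f : ℝ → X} {g : ℝ → Y} {a b C : ℝ}
    (hf : AbsolutelyContinuousOnInterval f a b)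
    (h : ∀ x ∈ uIcc a b, ∀ y ∈ uIcc a b, dist (g x) (g y) ≤ C * dist (f x) (f y)) :
    AbsolutelyContinuousOnInterval g a b := by
  unfold AbsolutelyContinuousOnInterval at hf ⊢
  have h0 := hf.const_mul C
  rw [mul_zero] at h0
  refine squeeze_zero' (Filter.Eventually.of_forall fun E =>
    Finset.sum_nonneg fun _ _ => dist_nonneg) ?_ h0
  rw [Filter.eventually_inf_principal]
  refine Filter.Eventually.of_forall fun E hE => ?_
  rw [Finset.mul_sum]
  refine Finset.sum_le_sum fun i hi => ?_
  have := hE.1 i hi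
  exact h _ this.1 _ this.2

/-- Integrated form of the differential inequality `u' ≤ a ψ(u)`. -/
theorem integral_inv_le_of_deriv_le_mul {u u' a ψ : ℝ → ℝ} {s t c e : ℝ} (hst : s ≤ t)
    (hu : AbsolutelyContinuousOnInterval u s t)
    (hu' : ∀ᵐ r, r ∈ Ioo s t → HasDerivAt u (u' r) r ∧ u' r ≤ a r * ψ (u r))
    (ha : IntervalIntegrable a volume s t)
    (hψ : ContinuousOn ψ (Icc c e)) (hψ0 : ∀ y ∈ Icc c e, 0 < ψ y)
    (hr : ∀ r ∈ Icc s t, u r ∈ Icc c e) :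
    ∫ y in u s..u t, 1 / ψ y ≤ ∫ r in s..t, a r := by
  have hus := hr s (left_mem_Icc.2 hst)
  have hut := hr t (right_mem_Icc.2 hst)
  have hce : c ≤ e := hus.1.trans hus.2
  set q : ℝ → ℝ := fun y => 1 / ψ (projIcc c e hce y) with hq
  have hqc : Continuous q := by
    have h1 : Continuous fun y : ℝ => ψ (projIcc c e hce y) :=
      hψ.comp_continuous (continuous_subtype_val.comp continuous_projIcc)
        fun y => (projIcc c e hce y).2
    exact continuous_const.div h1 fun y => (hψ0 _ (projIcc c e hce y).2).ne'
  have hqe : ∀ y ∈ Icc c e, q y = 1 / ψ y := fun y hy => by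
    simp only [hq, projIcc_of_mem hce hy]
  set Φ : ℝ → ℝ := fun y => ∫ z in c..y, q z with hΦ
  have hΦd : ∀ y, HasDerivAt Φ (q y) y := fun y => hqc.integral_hasStrictDerivAt c y |>.hasDerivAt
  obtain ⟨C, hC⟩ := isCompact_Icc.exists_bound_of_continuousOn (hqc.continuousOn (s := Icc c e))
  have hac : AbsolutelyContinuousOnInterval (fun r => Φ (u r)) s t := by
    refine hu.of_dist_le (C := C) fun x hx y hy => ?_
    rw [uIcc_of_le hst] at hx hy
    have := (convex_Icc c e).norm_image_sub_le_of_norm_hasDerivWithin_le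
      (fun z _ => (hΦd z).hasDerivWithinAt) hC (hr y hy) (hr x hx)
    simpa [dist_eq_norm] using this
  have hint := hac.integral_deriv_eq_sub
  have hsub : Φ (u t) - Φ (u s) = ∫ y in u s..u t, 1 / ψ y := by
    rw [hΦ]
    simp only
    rw [intervalIntegral.integral_interval_sub_left (hqc.intervalIntegrable _ _)
      (hqc.intervalIntegrable _ _)]
    refine intervalIntegral.integral_congr fun y hy => hqe y ?_
    exact (uIcc_subset_Icc hus hut) hy
  rw [← hsub, ← hint]
  refine intervalIntegral.integral_mono_ae_restrict hst hac.intervalIntegrable_deriv ha ?_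
  rw [← Measure.restrict_congr_set Ioo_ae_eq_Icc]
  filter_upwards [ae_restrict_of_ae hu', ae_restrict_mem measurableSet_Ioo] with r h1 h2
  obtain ⟨h3, h4⟩ := h1 h2
  have hm := hr r (Ioo_subset_Icc_self h2)
  have h5 : deriv (fun r => Φ (u r)) r = q (u r) * u' r := ((hΦd (u r)).comp r h3).deriv
  rw [h5, hqe _ hm, one_div, inv_mul_le_iff₀ (hψ0 _ hm), mul_comm]
  exact h4

theorem norm_sq_integral_absolutelyContinuous {E : Type*} [NormedAddCommGroup E]
    [InnerProductSpace ℝ E] [CompleteSpace E] {h f : ℝ → E} {x₀ : E}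
    (hf : IntervalIntegrable f volume 0 1)
    (hh : ∀ t ∈ Icc (0 : ℝ) 1, h t = x₀ + ∫ s in (0 : ℝ)..t, f s) :
    AbsolutelyContinuousOnInterval (fun t => ‖h t‖ ^ 2) 0 1 ∧
      ∀ᵐ r, r ∈ Ioo (0 : ℝ) 1 →
        HasDerivAt (fun t => ‖h t‖ ^ 2) (2 * ⟪h r, f r⟫) r := by
  have hsub : ∀ x ∈ Icc (0 : ℝ) 1, IntervalIntegrable f volume 0 x := fun x hx =>
    hf.mono_set (by rw [uIcc_of_le hx.1, uIcc_of_le zero_le_one]; exact Icc_subset_Icc_right hx.2)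
  have hd : ∀ x ∈ Icc (0 : ℝ) 1, ∀ y ∈ Icc (0 : ℝ) 1, dist (h x) (h y) ≤
      dist (∫ s in (0 : ℝ)..x, ‖f s‖) (∫ s in (0 : ℝ)..y, ‖f s‖) := fun x hx y hy => by
    rw [hh x hx, hh y hy, dist_add_left, dist_eq_norm, Real.dist_eq,
      intervalIntegral.integral_interval_sub_left (hsub x hx) (hsub y hy),
      intervalIntegral.integral_interval_sub_left (hsub x hx).norm (hsub y hy).norm]
    exact intervalIntegral.norm_integral_le_abs_integral_norm
  have hP : AbsolutelyContinuousOnInterval (fun x => ∫ s in (0 : ℝ)..x, ‖f s‖) 0 1 :=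
    hf.norm.absolutelyContinuousOnInterval_intervalIntegral (by simp)
  have hac : AbsolutelyContinuousOnInterval h 0 1 := hP.of_dist_le (C := 1) fun x hx y hy => by
    rw [uIcc_of_le zero_le_one] at hx hy
    simpa using hd x hx y hy
  constructor
  · have : AbsolutelyContinuousOnInterval (fun t => ‖h t‖) 0 1 :=
      hac.of_dist_le (C := 1) fun x _ y _ => by
        rw [one_mul, dist_eq_norm (h x)]
        exact dist_norm_norm_le (h x) (h y)
    simp only [sq]
    exact this.mul this
  · filter_upwards [hf.ae_hasDerivAt_integral] with r hr hr01
    have h1 := hr (by rw [uIcc_of_le zero_le_one]; exact Ioo_subset_Icc_self hr01) 0 (by simp)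
    have h2 : HasDerivAt h (f r) r := by
      refine (h1.const_add x₀).congr_of_eventuallyEq ?_
      filter_upwards [Icc_mem_nhds hr01.1 hr01.2] with t ht using hh t ht
    exact h2.norm_sq

theorem intervalIntegral_le_of_nonneg_of_subset {a : ℝ → ℝ} {s t : ℝ}
    (ha : IntervalIntegrable a volume 0 1) (ha0 : ∀ r, 0 ≤ a r) (h0 : 0 ≤ s) (hst : s ≤ t)
    (h1 : t ≤ 1) : ∫ r in s..t, a r ≤ ∫ r in (0 : ℝ)..1, a r :=
  intervalIntegral.integral_mono_interval h0 hst h1 (Filter.Eventually.of_forall ha0) ha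

/-- Osgood's lemma for absolutely continuous functions. -/
theorem eq_zero_of_deriv_le_osgood {u u' a η : ℝ → ℝ} {c : ℝ} (hc : 0 < c) (hc1 : c ≤ 1)
    (hu : AbsolutelyContinuousOnInterval u 0 1) (hu0 : u 0 = 0)
    (hpos : ∀ t ∈ Icc (0 : ℝ) 1, 0 ≤ u t)
    (hu' : ∀ᵐ r, r ∈ Ioo (0 : ℝ) 1 →
      HasDerivAt u (u' r) r ∧ (u r < c → u' r ≤ a r * η (u r)))
    (ha : IntervalIntegrable a volume 0 1) (ha0 : ∀ r, 0 ≤ a r)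
    (hη : ContinuousOn η (Ico 0 1)) (hη0 : ∀ y ∈ Ioo (0 : ℝ) 1, 0 < η y)
    (hηint : ∀ ε ∈ Ioo (0 : ℝ) 1, ∫⁻ y in Ioc (0 : ℝ) ε, ENNReal.ofReal (1 / η y) = ⊤) :
    ∀ t ∈ Icc (0 : ℝ) 1, u t = 0 := by
  intro t₁ ht₁
  by_contra hne
  have hcont : ContinuousOn u (Icc 0 1) := by
    simpa [uIcc_of_le (zero_le_one (α := ℝ))] using hu.continuousOn
  have hsub₁ : Icc 0 t₁ ⊆ Icc (0 : ℝ) 1 := Icc_subset_Icc_right ht₁.2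
  obtain ⟨t₀, ⟨ht₀, hut₀⟩, hmax⟩ : ∃ t₀, IsGreatest (Icc 0 t₁ ∩ u ⁻¹' {0}) t₀ :=
    (isCompact_Icc.of_isClosed_subset ((hcont.mono hsub₁).preimage_isClosed_of_isClosed
      isClosed_Icc isClosed_singleton) inter_subset_left).exists_isGreatest
      ⟨0, ⟨left_mem_Icc.2 ht₁.1, hu0⟩⟩
  have hut₀ : u t₀ = 0 := hut₀
  have hlt : t₀ < t₁ := lt_of_le_of_ne ht₀.2 fun h => hne (h ▸ hut₀)
  have hpos' : ∀ t ∈ Ioc t₀ t₁, 0 < u t := fun t ht =>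
    lt_of_le_of_ne (hpos t (hsub₁ ⟨ht₀.1.trans ht.1.le, ht.2⟩)) fun h =>
      (hmax ⟨⟨ht₀.1.trans ht.1.le, ht.2⟩, h.symm⟩).not_gt ht.1
  obtain ⟨δ, hδ, hδu⟩ := Metric.continuousOn_iff.1 hcont t₀ (hsub₁ ht₀) c hc
  set t₂ := min t₁ (t₀ + δ / 2) with ht₂
  have ht₀₂ : t₀ < t₂ := lt_min hlt (by linarith)
  have ht₂₁ : t₂ ≤ t₁ := min_le_left _ _
  have hsub₂ : Icc t₀ t₂ ⊆ Icc 0 1 := Icc_subset_Icc ht₀.1 (ht₂₁.trans ht₁.2)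
  have hltc : ∀ t ∈ Icc t₀ t₂, u t < c := fun t ht => by
    have h1 := hδu t (hsub₂ ht) (by
      rw [Real.dist_eq, abs_of_nonneg (by linarith [ht.1])]
      linarith [ht.2, min_le_right t₁ (t₀ + δ / 2)])
    rw [hut₀, Real.dist_eq, sub_zero] at h1
    exact (le_abs_self _).trans_lt h1
  have hε0 : 0 < u t₂ := hpos' t₂ ⟨ht₀₂, ht₂₁⟩
  have hε1 : u t₂ < c := hltc t₂ (right_mem_Icc.2 ht₀₂.le)
  have key : ∀ y ∈ Ioc 0 (u t₂), ∫ z in y..u t₂, 1 / η z ≤ ∫ r in (0 : ℝ)..1, a r := by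
    intro y hy
    obtain ⟨s, hs, hsy⟩ := intermediate_value_Icc ht₀₂.le (hcont.mono hsub₂)
      (⟨by rw [hut₀]; exact hy.1.le, hy.2⟩ : y ∈ Icc (u t₀) (u t₂))
    have hs0 : t₀ < s := lt_of_le_of_ne hs.1 fun h => by
      rw [← h, hut₀] at hsy
      exact hy.1.ne hsy
    have hcs : ContinuousOn u (Icc s t₂) := hcont.mono ((Icc_subset_Icc_left hs.1).trans hsub₂)
    obtain ⟨p, hp, hpm⟩ := isCompact_Icc.exists_isMinOn (nonempty_Icc.2 hs.2) hcs
    obtain ⟨q, hq, hqm⟩ := isCompact_Icc.exists_isMaxOn (nonempty_Icc.2 hs.2) hcs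
    have hup : 0 < u p := hpos' p ⟨hs0.trans_le hp.1, hp.2.trans ht₂₁⟩
    have huq : u q < c := hltc q ⟨hs.1.trans hq.1, hq.2⟩
    have hrange : ∀ z ∈ Icc (u p) (u q), z ∈ Ioo (0 : ℝ) 1 := fun z hz =>
      ⟨hup.trans_le hz.1, hz.2.trans_lt (huq.trans_le hc1)⟩
    have hs01 := hsub₂ hs
    have hs1 : uIcc s t₂ ⊆ uIcc 0 1 := by
      rw [uIcc_of_le hs.2, uIcc_of_le zero_le_one]
      exact (Icc_subset_Icc_left hs.1).trans hsub₂
    rw [← hsy]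
    refine (integral_inv_le_of_deriv_le_mul (u' := u') hs.2 (hu.mono hs1) ?_ (ha.mono_set hs1)
      (hη.mono fun z hz => Ioo_subset_Ico_self (hrange z hz)) (fun z hz => hη0 z (hrange z hz))
      fun r hr => ⟨hpm hr, hqm hr⟩).trans
      (intervalIntegral_le_of_nonneg_of_subset ha ha0 hs01.1 hs.2 (ht₂₁.trans ht₁.2))
    filter_upwards [hu'] with r hr hrs
    have hr' := hr ⟨hs01.1.trans_lt hrs.1, hrs.2.trans_le (ht₂₁.trans ht₁.2)⟩
    exact ⟨hr'.1, hr'.2 (hltc r ⟨hs.1.trans hrs.1.le, hrs.2.le⟩)⟩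
  have hyn : ∀ n : ℕ, u t₂ / (n + 1 : ℝ) ∈ Ioc 0 (u t₂) := fun n =>
    ⟨by positivity, div_le_self hε0.le (by linarith [n.cast_nonneg (α := ℝ)])⟩
  have hint : IntegrableOn (fun z => 1 / η z) (Ioc 0 (u t₂)) := by
    refine integrableOn_Ioc_of_intervalIntegral_norm_bounded_left (l := Filter.atTop)
      (a := fun n : ℕ => u t₂ / (n + 1 : ℝ)) (I := ∫ r in (0 : ℝ)..1, a r) (fun n => ?_)
      (tendsto_const_div_atTop_nhds_zero_nat (u t₂) |>.comp (Filter.tendsto_add_atTop_nat 1)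
        |>.congr fun n => by simp) (Filter.Eventually.of_forall fun n => ?_)
    · refine (ContinuousOn.integrableOn_Icc ?_).mono_set Ioc_subset_Icc_self
      have hr : ∀ z ∈ Icc (u t₂ / (n + 1 : ℝ)) (u t₂), z ∈ Ioo (0 : ℝ) 1 := fun z hz =>
        ⟨(hyn n).1.trans_le hz.1, hz.2.trans_lt (hε1.trans_le hc1)⟩
      exact continuousOn_const.div (hη.mono fun z hz => Ioo_subset_Ico_self (hr z hz))
        fun z hz => (hη0 z (hr z hz)).ne'
    · refine le_trans (le_of_eq ?_) (key _ (hyn n))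
      rw [intervalIntegral.integral_of_le (hyn n).2]
      refine setIntegral_congr_fun measurableSet_Ioc fun z hz => ?_
      have : 0 < η z := hη0 z ⟨(hyn n).1.trans hz.1, hz.2.trans_lt (hε1.trans_le hc1)⟩
      exact Real.norm_of_nonneg (by positivity)
  exact (hint.lintegral_lt_top).ne (hηint _ ⟨hε0, hε1.trans_le hc1⟩)

/-- An absolutely continuous function with `u' ≤ a ψ(u)` while `L ≤ u ≤ M` cannot climb
from `L` to `M` if `∫ a < ∫ dy / ψ(y)`. -/
theorem lt_of_deriv_le_of_integral_lt {u u' a ψ : ℝ → ℝ} {L M : ℝ} (hLM : L < M)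
    (hu : AbsolutelyContinuousOnInterval u 0 1) (hu0 : u 0 ≤ L)
    (hu' : ∀ᵐ r, r ∈ Ioo (0 : ℝ) 1 →
      HasDerivAt u (u' r) r ∧ (u r ∈ Icc L M → u' r ≤ a r * ψ (u r)))
    (ha : IntervalIntegrable a volume 0 1) (ha0 : ∀ r, 0 ≤ a r)
    (hψ : ContinuousOn ψ (Icc L M)) (hψ0 : ∀ y ∈ Icc L M, 0 < ψ y)
    (hlt : ∫ r in (0 : ℝ)..1, a r < ∫ y in L..M, 1 / ψ y) :
    ∀ t ∈ Icc (0 : ℝ) 1, u t < M := by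
  intro t ht
  by_contra! hMt
  have hcont : ContinuousOn u (Icc 0 1) := by
    simpa [uIcc_of_le (zero_le_one (α := ℝ))] using hu.continuousOn
  have hsub : Icc 0 t ⊆ Icc (0 : ℝ) 1 := Icc_subset_Icc_right ht.2
  obtain ⟨t₂, ⟨ht₂, hut₂⟩, hmin⟩ : ∃ t₂, IsLeast (Icc 0 t ∩ u ⁻¹' (Ici M)) t₂ :=
    (isCompact_Icc.of_isClosed_subset ((hcont.mono hsub).preimage_isClosed_of_isClosed
      isClosed_Icc isClosed_Ici) inter_subset_left).exists_isLeast
      ⟨t, ⟨right_mem_Icc.2 ht.1, hMt⟩⟩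
  have hsub₂ : Icc 0 t₂ ⊆ Icc (0 : ℝ) 1 := Icc_subset_Icc_right (ht₂.2.trans ht.2)
  have hut₂ : u t₂ = M := by
    obtain ⟨x, hx, hxM⟩ := intermediate_value_Icc ht₂.1 (hcont.mono hsub₂)
      (⟨hu0.trans hLM.le, hut₂⟩ : M ∈ Icc (u 0) (u t₂))
    rw [← hxM, (hx.2.antisymm (hmin ⟨⟨hx.1, hx.2.trans ht₂.2⟩, hxM.ge⟩))]
  have hle : ∀ x ∈ Icc 0 t₂, u x ≤ M := fun x hx => by
    by_contra! h
    rw [hx.2.antisymm (hmin ⟨⟨hx.1, hx.2.trans ht₂.2⟩, h.le⟩), hut₂] at h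
    exact lt_irrefl _ h
  obtain ⟨t₁, ⟨ht₁, hut₁⟩, hmax⟩ : ∃ t₁, IsGreatest (Icc 0 t₂ ∩ u ⁻¹' (Iic L)) t₁ :=
    (isCompact_Icc.of_isClosed_subset ((hcont.mono hsub₂).preimage_isClosed_of_isClosed
      isClosed_Icc isClosed_Iic) inter_subset_left).exists_isGreatest
      ⟨0, ⟨left_mem_Icc.2 ht₂.1, hu0⟩⟩
  have hsub₁ : Icc t₁ t₂ ⊆ Icc (0 : ℝ) 1 := (Icc_subset_Icc_left ht₁.1).trans hsub₂
  have hut₁ : u t₁ = L := by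
    obtain ⟨x, hx, hxL⟩ := intermediate_value_Icc ht₁.2 (hcont.mono hsub₁)
      (⟨hut₁, hLM.le.trans hut₂.ge⟩ : L ∈ Icc (u t₁) (u t₂))
    rw [← hxL, (hx.1.antisymm (hmax ⟨⟨ht₁.1.trans hx.1, hx.2⟩, hxL.le⟩))]
  have hge : ∀ x ∈ Icc t₁ t₂, L ≤ u x := fun x hx => by
    by_contra! h
    rw [← hx.1.antisymm (hmax ⟨⟨ht₁.1.trans hx.1, hx.2⟩, h.le⟩), hut₁] at h
    exact lt_irrefl _ h
  have hs1 : uIcc t₁ t₂ ⊆ uIcc 0 1 := by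
    rwa [uIcc_of_le ht₁.2, uIcc_of_le zero_le_one]
  have hmem : ∀ x ∈ Icc t₁ t₂, u x ∈ Icc L M := fun x hx =>
    ⟨hge x hx, hle x ⟨ht₁.1.trans hx.1, hx.2⟩⟩
  have := (integral_inv_le_of_deriv_le_mul (u' := u') ht₁.2 (hu.mono hs1) (by
      filter_upwards [hu'] with r hr hrs
      have hr' := hr ⟨ht₁.1.trans_lt hrs.1, hrs.2.trans_le (ht₂.2.trans ht.2)⟩
      exact ⟨hr'.1, hr'.2 (hmem r (Ioo_subset_Icc_self hrs))⟩) (ha.mono_set hs1) hψ hψ0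
      hmem).trans
      (intervalIntegral_le_of_nonneg_of_subset ha ha0 ht₁.1 ht₁.2 (ht₂.2.trans ht.2))
  rw [hut₁, hut₂] at this
  exact this.not_gt hlt

/-- The integral operator with delay `δ`, whose approximate fixed points are Tonelli's
approximate solutions. -/
def delayedPicard {E : Type*} [NormedAddCommGroup E] [NormedSpace ℝ E] (F : ℝ → E → E) (x₀ : E)
    (δ : ℝ) (h : ℝ → E) (t : ℝ) : E :=
  x₀ + ∫ s in (0 : ℝ)..projIcc (0 : ℝ) 1 zero_le_one t, F s (h (max 0 (s - δ)))

section Caratheodory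

variable {E : Type*} [NormedAddCommGroup E] [NormedSpace ℝ E] {F : ℝ → E → E} {M : ℝ → ℝ}

omit [NormedSpace ℝ E] in
theorem intervalIntegrable_comp_of_norm_le
    (hFm : ∀ h : ℝ → E, Continuous h →
      AEStronglyMeasurable (fun s => F s (h s)) (volume.restrict (Icc 0 1)))
    (hM : IntegrableOn M (Icc 0 1)) (hb : ∀ s ∈ Icc (0 : ℝ) 1, ∀ x, ‖F s x‖ ≤ M s)
    {h : ℝ → E} (hh : Continuous h) {s t : ℝ} (hs : s ∈ Icc (0 : ℝ) 1) (ht : t ∈ Icc (0 : ℝ) 1) :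
    IntervalIntegrable (fun s => F s (h s)) volume s t := by
  have h1 : IntegrableOn (fun s => F s (h s)) (Icc 0 1) :=
    Integrable.mono' hM (hFm h hh)
      ((ae_restrict_mem measurableSet_Icc).mono fun s hs => hb s hs (h s))
  have h2 : IntegrableOn (fun s => F s (h s)) (uIcc (0 : ℝ) 1) := by
    rwa [uIcc_of_le zero_le_one]
  exact h2.intervalIntegrable.mono_set
    (uIcc_subset_uIcc (by rwa [uIcc_of_le zero_le_one]) (by rwa [uIcc_of_le zero_le_one]))

theorem dist_delayedPicard_le
    (hFm : ∀ h : ℝ → E, Continuous h →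
      AEStronglyMeasurable (fun s => F s (h s)) (volume.restrict (Icc 0 1)))
    (hM : IntegrableOn M (Icc 0 1)) (hb : ∀ s ∈ Icc (0 : ℝ) 1, ∀ x, ‖F s x‖ ≤ M s)
    (x₀ : E) (δ : ℝ) {h : ℝ → E} (hh : Continuous h) (s t : ℝ) :
    dist (delayedPicard F x₀ δ h s) (delayedPicard F x₀ δ h t) ≤
      dist (∫ r in (0 : ℝ)..projIcc (0 : ℝ) 1 zero_le_one s, M r)
        (∫ r in (0 : ℝ)..projIcc (0 : ℝ) 1 zero_le_one t, M r) := by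
  have hh' : Continuous fun s => h (max 0 (s - δ)) := by fun_prop
  have h0 : (0 : ℝ) ∈ Icc (0 : ℝ) 1 := by simp
  have hMi : ∀ t ∈ Icc (0 : ℝ) 1, IntervalIntegrable M volume 0 t := fun t ht =>
    IntegrableOn.intervalIntegrable (hM.mono_set (by
      rw [uIcc_of_le ht.1]; exact Icc_subset_Icc_right ht.2))
  unfold delayedPicard
  generalize projIcc (0 : ℝ) 1 zero_le_one s = s
  generalize projIcc (0 : ℝ) 1 zero_le_one t = t
  wlog hst : (s : ℝ) ≤ t generalizing s t
  · rw [dist_comm, dist_comm (∫ r in (0 : ℝ)..s, M r)]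
    exact this t s (le_of_not_ge hst)
  rw [dist_add_left, dist_comm, dist_comm (∫ r in (0 : ℝ)..s, M r), dist_eq_norm, Real.dist_eq,
    intervalIntegral.integral_interval_sub_left
      (intervalIntegrable_comp_of_norm_le hFm hM hb hh' h0 t.2)
      (intervalIntegrable_comp_of_norm_le hFm hM hb hh' h0 s.2),
    intervalIntegral.integral_interval_sub_left (hMi _ t.2) (hMi _ s.2)]
  refine (intervalIntegral.norm_integral_le_of_norm_le hst
    (Filter.Eventually.of_forall fun r hr => hb r ⟨s.2.1.trans hr.1.le, hr.2.trans t.2.2⟩ _)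
    ((hMi _ s.2).symm.trans (hMi _ t.2))).trans (le_abs_self _)

theorem continuous_integral_projIcc (hM : IntegrableOn M (Icc 0 1)) :
    Continuous fun t => ∫ r in (0 : ℝ)..projIcc (0 : ℝ) 1 zero_le_one t, M r := by
  have h1 : ContinuousOn (fun t => ∫ r in (0 : ℝ)..t, M r) (Icc 0 1) := by
    have := intervalIntegral.continuousOn_primitive_interval (μ := volume) (f := M)
      (a := 0) (b := 1) (by rwa [uIcc_of_le zero_le_one])
    rwa [uIcc_of_le zero_le_one] at this
  exact h1.comp_continuous (continuous_subtype_val.comp continuous_projIcc) fun t => Subtype.prop _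

theorem continuous_delayedPicard
    (hFm : ∀ h : ℝ → E, Continuous h →
      AEStronglyMeasurable (fun s => F s (h s)) (volume.restrict (Icc 0 1)))
    (hM : IntegrableOn M (Icc 0 1)) (hb : ∀ s ∈ Icc (0 : ℝ) 1, ∀ x, ‖F s x‖ ≤ M s)
    (x₀ : E) (δ : ℝ) {h : ℝ → E} (hh : Continuous h) :
    Continuous (delayedPicard F x₀ δ h) := by
  rw [continuous_iff_continuousAt]
  intro t
  have := (continuous_integral_projIcc hM).tendsto t
  rw [tendsto_iff_dist_tendsto_zero] at this
  exact tendsto_iff_dist_tendsto_zero.2 (squeeze_zero (fun _ => dist_nonneg)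
    (fun s => dist_delayedPicard_le hFm hM hb x₀ δ hh s t) this)

theorem delayedPicard_iterate_succ_eq (x₀ : E) {δ : ℝ} (hδ : 0 ≤ δ) (k : ℕ) :
    ∀ t ≤ k * δ, (delayedPicard F x₀ δ)^[k + 1] (fun _ => x₀) t =
      (delayedPicard F x₀ δ)^[k] (fun _ => x₀) t := by
  induction k with
  | zero =>
    intro t ht
    have : projIcc (0 : ℝ) 1 zero_le_one t = ⟨0, by simp⟩ :=
      projIcc_of_le_left _ (by simpa using ht)
    simp [delayedPicard, this]
  | succ k ih =>
    intro t ht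
    rw [Function.iterate_succ_apply']
    nth_rewrite 2 [Function.iterate_succ_apply']
    generalize (delayedPicard F x₀ δ)^[k + 1] (fun _ => x₀) = h₁ at ih ⊢
    generalize (delayedPicard F x₀ δ)^[k] (fun _ => x₀) = h₂ at ih ⊢
    unfold delayedPicard
    congr 1
    set p := projIcc (0 : ℝ) 1 zero_le_one t with hp
    refine intervalIntegral.integral_congr fun s hs => ?_
    rw [uIcc_of_le p.2.1] at hs
    have hpt : (p : ℝ) ≤ (k + 1) * δ := by
      rw [hp, coe_projIcc]
      push_cast at ht
      exact max_le (by positivity) ((min_le_right _ _).trans ht)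
    have hsδ : max 0 (s - δ) ≤ k * δ := max_le (by positivity) (by linarith [hs.2])
    exact congrArg (F s) (ih _ hsδ)

/-- Peano–Carathéodory existence theorem for a right-hand side dominated by an integrable
function of time. -/
theorem exists_eq_integral_of_norm_le [FiniteDimensional ℝ E]
    (hFc : ∀ s ∈ Icc (0 : ℝ) 1, Continuous (F s))
    (hFm : ∀ h : ℝ → E, Continuous h →
      AEStronglyMeasurable (fun s => F s (h s)) (volume.restrict (Icc 0 1)))
    (hM : IntegrableOn M (Icc 0 1)) (hb : ∀ s ∈ Icc (0 : ℝ) 1, ∀ x, ‖F s x‖ ≤ M s) (x₀ : E) :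
    ∃ h : ℝ → E, Continuous h ∧
      ∀ t ∈ Icc (0 : ℝ) 1, h t = x₀ + ∫ s in (0 : ℝ)..t, F s (h s) := by
  have := FiniteDimensional.proper_real E
  set δ : ℕ → ℝ := fun n => 1 / (n + 1 : ℝ) with hδ
  have hδ0 : ∀ n, 0 ≤ δ n := fun n => by positivity
  set k : ℕ → ℝ → E := fun n => (delayedPicard F x₀ (δ n))^[n + 1] fun _ => x₀ with hk
  have hiter : ∀ n j, Continuous ((delayedPicard F x₀ (δ n))^[j] fun _ => x₀) := fun n j => by
    induction j with
    | zero => exact continuous_const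
    | succ j ih =>
      rw [Function.iterate_succ_apply']
      exact continuous_delayedPicard hFm hM hb x₀ _ ih
  have hkc : ∀ n, Continuous (k n) := fun n => hiter n _
  have hkeq : ∀ n, ∀ t ∈ Icc (0 : ℝ) 1,
      k n t = x₀ + ∫ s in (0 : ℝ)..t, F s (k n (max 0 (s - δ n))) := fun n t ht => by
    have h1 := delayedPicard_iterate_succ_eq (F := F) x₀ (hδ0 n) (n + 1) t (by
      have : ((n + 1 : ℕ) : ℝ) * δ n = 1 := by
        rw [hδ]; push_cast; field_simp
      rw [this]
      exact ht.2)
    rw [Function.iterate_succ_apply', delayedPicard, projIcc_of_mem zero_le_one ht] at h1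
    exact h1.symm
  have hkd : ∀ n s t, dist (k n s) (k n t) ≤
      dist (∫ r in (0 : ℝ)..projIcc (0 : ℝ) 1 zero_le_one s, M r)
        (∫ r in (0 : ℝ)..projIcc (0 : ℝ) 1 zero_le_one t, M r) := fun n s t => by
    simp only [hk, Function.iterate_succ_apply']
    exact dist_delayedPicard_le hFm hM hb x₀ _ (hiter n n) s t
  set P : ℝ → ℝ := fun t => ∫ r in (0 : ℝ)..projIcc (0 : ℝ) 1 zero_le_one t, M r with hP
  have hPc : Continuous P := continuous_integral_projIcc hM
  obtain ⟨C, hC⟩ := isCompact_Icc.exists_bound_of_continuousOn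
    (hPc.continuousOn (s := Icc (0 : ℝ) 1))
  set φ : ℕ → BoundedContinuousFunction (Icc (0 : ℝ) 1) E := fun n =>
    BoundedContinuousFunction.mkOfCompact ⟨fun t => k n t, (hkc n).comp continuous_subtype_val⟩
    with hφ
  have hφk : ∀ n (t : Icc (0 : ℝ) 1), φ n t = k n t := fun n t => rfl
  have hcomp : IsCompact (closure (range φ)) := by
    refine BoundedContinuousFunction.arzela_ascoli (closedBall x₀ C)
      (isCompact_closedBall _ _) _ ?_ ?_
    · rintro f x ⟨n, rfl⟩
      have h0 : k n 0 = x₀ := by rw [hkeq n 0 (by simp)]; simp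
      have hP0 : P 0 = 0 := by simp [hP, projIcc_left]
      have := hkd n x 0
      rw [h0] at this
      rw [mem_closedBall, hφk]
      refine this.trans ?_
      change dist (P x) (P 0) ≤ C
      rw [hP0, dist_zero_right]
      exact hC x x.2
    · intro x
      rw [Metric.equicontinuousAt_iff]
      intro ε hε
      obtain ⟨d, hd, hdP⟩ := Metric.continuous_iff.1 (hPc.comp continuous_subtype_val) x ε hε
      refine ⟨d, hd, ?_⟩
      rintro y hy ⟨_, n, rfl⟩
      rw [dist_comm]
      exact (hkd n y x).trans_lt (hdP y hy)
  obtain ⟨f, -, ν, hν, hlim⟩ := hcomp.tendsto_subseq fun n => subset_closure (mem_range_self n)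
  have hunif := BoundedContinuousFunction.tendsto_iff_tendstoUniformly.1 hlim
  have hδlim : Filter.Tendsto (fun n => δ (ν n)) Filter.atTop (nhds 0) :=
    tendsto_one_div_add_atTop_nhds_zero_nat.comp hν.tendsto_atTop
  refine ⟨fun t => f (projIcc 0 1 zero_le_one t), f.continuous.comp continuous_projIcc,
    fun t ht => ?_⟩
  beta_reduce
  rw [projIcc_of_mem zero_le_one ht]
  have hL : Filter.Tendsto (fun n => k (ν n) t) Filter.atTop (nhds (f ⟨t, ht⟩)) :=
    hunif.tendsto_at ⟨t, ht⟩
  refine tendsto_nhds_unique hL ?_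
  simp only [hkeq _ t ht]
  refine Filter.Tendsto.const_add _ ?_
  have hsub : uIoc 0 t ⊆ Icc (0 : ℝ) 1 := by
    rw [uIoc_of_le ht.1]
    exact fun s hs => ⟨hs.1.le, hs.2.trans ht.2⟩
  refine intervalIntegral.tendsto_integral_filter_of_dominated_convergence M ?_ ?_ ?_ ?_
  · refine Filter.Eventually.of_forall fun n => ?_
    have hc : Continuous fun s => k (ν n) (max 0 (s - δ (ν n))) := (hkc _).comp (by fun_prop)
    exact (hFm _ hc).mono_measure (Measure.restrict_mono hsub le_rfl)
  · exact Filter.Eventually.of_forall fun n => Filter.Eventually.of_forall fun s hs =>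
      hb s (hsub hs) _
  · exact IntegrableOn.intervalIntegrable (hM.mono_set (by
      rw [uIcc_of_le ht.1]; exact Icc_subset_Icc_right ht.2))
  · refine Filter.Eventually.of_forall fun s hs => ?_
    have hs01 := hsub hs
    rw [projIcc_of_mem zero_le_one hs01]
    refine ((hFc s hs01).tendsto _).comp ?_
    have hmem : ∀ n, max 0 (s - δ (ν n)) ∈ Icc (0 : ℝ) 1 := fun n =>
      ⟨le_max_left _ _, max_le zero_le_one (by linarith [hδ0 (ν n), hs01.2])⟩
    have hg : Filter.Tendsto (fun n => (⟨max 0 (s - δ (ν n)), hmem n⟩ : Icc (0 : ℝ) 1))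
        Filter.atTop (nhds ⟨s, hs01⟩) := by
      rw [tendsto_subtype_rng]
      have := (tendsto_const_nhds (x := (0 : ℝ))).max (hδlim.const_sub s)
      simpa [max_eq_right hs01.1] using this
    exact hunif.tendsto_comp f.continuous.continuousAt hg

end Caratheodory

section WellPosedness

variable {E : Type*} [NormedAddCommGroup E] [InnerProductSpace ℝ E]

/-- Radial retraction onto the closed ball of radius `R`. -/
def radialRetraction (R : ℝ) (x : E) : E := (R / max R ‖x‖) • x

theorem continuous_radialRetraction {R : ℝ} (hR : 0 < R) :
    Continuous (radialRetraction R : E → E) := by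
  unfold radialRetraction
  exact (continuous_const.div (by fun_prop) fun x => (hR.trans_le (le_max_left _ _)).ne').smul
    continuous_id

theorem norm_radialRetraction_le {R : ℝ} (hR : 0 < R) (x : E) : ‖radialRetraction R x‖ ≤ R := by
  have h : 0 < max R ‖x‖ := hR.trans_le (le_max_left _ _)
  rw [radialRetraction, norm_smul, Real.norm_of_nonneg (by positivity), div_mul_eq_mul_div,
    div_le_iff₀ h]
  gcongr
  exact le_max_right _ _

theorem radialRetraction_of_norm_le {R : ℝ} (hR : 0 < R) {x : E} (hx : ‖x‖ ≤ R) :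
    radialRetraction R x = x := by
  rw [radialRetraction, max_eq_left hx, div_self hR.ne', one_smul]

theorem exists_lt_integral_of_lintegral_eq_top {q : ℝ → ℝ} {K L : ℝ} (hKL : K ≤ L)
    (hq : ContinuousOn q (Ici K)) (hq0 : ∀ y ∈ Ici K, 0 ≤ q y)
    (hint : ∫⁻ y in Ioi K, ENNReal.ofReal (q y) = ⊤) (A : ℝ) :
    ∃ M, L < M ∧ A < ∫ y in L..M, q y := by
  by_contra! hcon
  have hi : ∀ a b, K ≤ a → IntegrableOn q (Ioc a b) := fun a b ha =>
    ((hq.mono fun z hz => ha.trans hz.1).integrableOn_Icc (a := a) (b := b)).mono_set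
      Ioc_subset_Icc_self
  have h1 : IntegrableOn q (Ioi L) := by
    refine integrableOn_Ioi_of_intervalIntegral_norm_bounded (l := Filter.atTop)
      (b := fun x : ℝ => x) A L (fun i => hi L i hKL) Filter.tendsto_id ?_
    filter_upwards [Filter.eventually_gt_atTop L] with M hM
    refine le_trans (le_of_eq (intervalIntegral.integral_congr fun z hz => ?_)) (hcon M hM)
    rw [uIcc_of_le hM.le] at hz
    exact Real.norm_of_nonneg (hq0 z (hKL.trans hz.1))
  have h2 : IntegrableOn q (Ioi K) := by
    rw [← Ioc_union_Ioi_eq_Ioi hKL]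
    exact (hi K L le_rfl).union h1
  exact h2.lintegral_lt_top.ne hint

/-- Global existence for a Carathéodory equation under a one-sided growth condition. -/
theorem exists_eq_integral_of_inner_le [FiniteDimensional ℝ E] {F : ℝ → E → E}
    (hFc : ∀ s ∈ Icc (0 : ℝ) 1, Continuous (F s))
    (hFm : ∀ h : ℝ → E, Continuous h →
      AEStronglyMeasurable (fun s => F s (h s)) (volume.restrict (Icc 0 1)))
    (hM : ∀ R : ℝ, 0 < R → ∃ M : ℝ → ℝ, IntegrableOn M (Icc 0 1) ∧
      ∀ s ∈ Icc (0 : ℝ) 1, ∀ x, ‖x‖ ≤ R → ‖F s x‖ ≤ M s)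
    {a ψ : ℝ → ℝ} {K : ℝ} (hK : 0 < K) (ha : IntervalIntegrable a volume 0 1)
    (ha0 : ∀ r, 0 ≤ a r) (hψ : ContinuousOn ψ (Ici 0)) (hψ0 : ∀ y ∈ Ici (0 : ℝ), 0 < ψ y)
    (hψint : ∫⁻ y in Ioi K, ENNReal.ofReal (1 / ψ y) = ⊤)
    (hgrowth : ∀ s ∈ Icc (0 : ℝ) 1, ∀ x, K ≤ ‖x‖ → 2 * ⟪x, F s x⟫ ≤ a s * ψ (‖x‖ ^ 2))
    (x₀ : E) :
    ∃ h : ℝ → E, Continuous h ∧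
      ∀ t ∈ Icc (0 : ℝ) 1, h t = x₀ + ∫ s in (0 : ℝ)..t, F s (h s) := by
  have := FiniteDimensional.complete ℝ E
  set L := max K (max (K ^ 2) (‖x₀‖ ^ 2)) with hL
  have hKL : K ≤ L := le_max_left _ _
  have hK2L : K ^ 2 ≤ L := (le_max_left _ _).trans (le_max_right _ _)
  have hx₀L : ‖x₀‖ ^ 2 ≤ L := (le_max_right _ _).trans (le_max_right _ _)
  obtain ⟨B, hLB, hB⟩ := exists_lt_integral_of_lintegral_eq_top (q := fun y => 1 / ψ y) hKL
    (continuousOn_const.div (hψ.mono (Ici_subset_Ici.2 hK.le)) fun y hy =>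
      (hψ0 y (hK.le.trans hy)).ne')
    (fun y hy => one_div_nonneg.2 (hψ0 y (hK.le.trans hy)).le) hψint (∫ r in (0 : ℝ)..1, a r)
  have hB0 : 0 < B := hK.trans_le (hKL.trans hLB.le)
  set R := Real.sqrt B with hR
  have hR0 : 0 < R := Real.sqrt_pos.2 hB0
  obtain ⟨M, hMi, hMb⟩ := hM R hR0
  have hπ := continuous_radialRetraction (E := E) hR0
  obtain ⟨h, hc, heq⟩ := exists_eq_integral_of_norm_le (F := fun s x => F s (radialRetraction R x))
    (fun s hs => (hFc s hs).comp hπ) (fun h hh => hFm _ (hπ.comp hh)) hMi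
    (fun s hs x => hMb s hs _ (norm_radialRetraction_le hR0 x)) x₀
  have hint := intervalIntegrable_comp_of_norm_le
    (F := fun s x => F s (radialRetraction R x)) (fun h hh => hFm _ (hπ.comp hh)) hMi
    (fun s hs x => hMb s hs _ (norm_radialRetraction_le hR0 x)) hc
    (left_mem_Icc.2 zero_le_one) (right_mem_Icc.2 zero_le_one)
  obtain ⟨hac, hder⟩ := norm_sq_integral_absolutelyContinuous hint heq
  have hlt := lt_of_deriv_le_of_integral_lt (a := a) (ψ := ψ) hLB hac
    (by simpa [heq 0 (by simp)] using hx₀L)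
    (by
      filter_upwards [hder] with r hr hr01
      refine ⟨hr hr01, fun hmem => ?_⟩
      rw [radialRetraction_of_norm_le hR0 (Real.le_sqrt_of_sq_le hmem.2)]
      exact hgrowth r (Ioo_subset_Icc_self hr01) _
        (le_of_sq_le_sq (hK2L.trans hmem.1) (norm_nonneg _)))
    ha ha0 (hψ.mono fun y hy => (hK.le.trans hKL).trans hy.1)
    (fun y hy => hψ0 y ((hK.le.trans hKL).trans hy.1)) hB
  refine ⟨h, hc, fun t ht => ?_⟩
  rw [heq t ht]
  congr 1
  refine intervalIntegral.integral_congr fun s hs => ?_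
  rw [uIcc_of_le ht.1] at hs
  rw [radialRetraction_of_norm_le hR0
    (Real.le_sqrt_of_sq_le (hlt s ⟨hs.1, hs.2.trans ht.2⟩).le)]

/-- Uniqueness for a Carathéodory equation under a one-sided Osgood condition. -/
theorem eqOn_of_eq_integral_of_osgood [CompleteSpace E] {F : ℝ → E → E}
    (hFm : ∀ h : ℝ → E, Continuous h →
      AEStronglyMeasurable (fun s => F s (h s)) (volume.restrict (Icc 0 1)))
    (hM : ∀ R : ℝ, 0 < R → ∃ M : ℝ → ℝ, IntegrableOn M (Icc 0 1) ∧
      ∀ s ∈ Icc (0 : ℝ) 1, ∀ x, ‖x‖ ≤ R → ‖F s x‖ ≤ M s)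
    {c₀ : ℝ} (hc₀ : c₀ ∈ Ioo (0 : ℝ) 1)
    (hOsg : ∀ R : ℝ, 0 < R → ∃ a η : ℝ → ℝ, (∀ t, 0 ≤ a t) ∧ IntervalIntegrable a volume 0 1 ∧
      ContinuousOn η (Ico 0 1) ∧ (∀ y ∈ Ioo (0 : ℝ) 1, 0 < η y) ∧
      (∀ ε ∈ Ioo (0 : ℝ) 1, ∫⁻ y in Ioc (0 : ℝ) ε, ENNReal.ofReal (1 / η y) = ⊤) ∧
      ∀ s ∈ Icc (0 : ℝ) 1, ∀ x y, ‖x‖ ≤ R → ‖y‖ ≤ R → ‖x - y‖ < c₀ →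
        2 * ⟪x - y, F s x - F s y⟫ ≤ a s * η (‖x - y‖ ^ 2))
    {x₀ : E} {h₁ h₂ : ℝ → E} (hc₁ : ContinuousOn h₁ (Icc 0 1)) (hc₂ : ContinuousOn h₂ (Icc 0 1))
    (heq₁ : ∀ t ∈ Icc (0 : ℝ) 1, h₁ t = x₀ + ∫ s in (0 : ℝ)..t, F s (h₁ s))
    (heq₂ : ∀ t ∈ Icc (0 : ℝ) 1, h₂ t = x₀ + ∫ s in (0 : ℝ)..t, F s (h₂ s)) :
    EqOn h₁ h₂ (Icc 0 1) := by
  obtain ⟨C₁, hC₁⟩ := isCompact_Icc.exists_bound_of_continuousOn hc₁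
  obtain ⟨C₂, hC₂⟩ := isCompact_Icc.exists_bound_of_continuousOn hc₂
  set R := max 1 (max C₁ C₂) with hR
  have hR0 : 0 < R := zero_lt_one.trans_le (le_max_left _ _)
  have hb₁ : ∀ t ∈ Icc (0 : ℝ) 1, ‖h₁ t‖ ≤ R := fun t ht =>
    (hC₁ t ht).trans ((le_max_left _ _).trans (le_max_right _ _))
  have hb₂ : ∀ t ∈ Icc (0 : ℝ) 1, ‖h₂ t‖ ≤ R := fun t ht =>
    (hC₂ t ht).trans ((le_max_right _ _).trans (le_max_right _ _))
  obtain ⟨M, hMi, hMb⟩ := hM R hR0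
  obtain ⟨a, η, ha0, ha, hη, hη0, hηint, hF⟩ := hOsg R hR0
  have hint : ∀ h : ℝ → E, ContinuousOn h (Icc 0 1) → (∀ t ∈ Icc (0 : ℝ) 1, ‖h t‖ ≤ R) →
      ∀ t ∈ Icc (0 : ℝ) 1, IntervalIntegrable (fun s => F s (h s)) volume 0 t := by
    intro h hc hb t ht
    refine IntegrableOn.intervalIntegrable ?_
    rw [uIcc_of_le ht.1]
    refine IntegrableOn.mono_set ?_ (Icc_subset_Icc_right ht.2)
    refine Integrable.mono' hMi ?_
      ((ae_restrict_mem measurableSet_Icc).mono fun s hs => hMb s hs _ (hb s hs))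
    refine (hFm (fun s => h (projIcc 0 1 zero_le_one s)) (hc.comp_continuous
      (continuous_subtype_val.comp (continuous_projIcc (h := zero_le_one)))
      fun t => Subtype.prop _)).congr ?_
    filter_upwards [ae_restrict_mem measurableSet_Icc] with s hs
    rw [projIcc_of_mem zero_le_one hs]
  have hi₁ := hint h₁ hc₁ hb₁
  have hi₂ := hint h₂ hc₂ hb₂
  have h1 : (1 : ℝ) ∈ Icc (0 : ℝ) 1 := right_mem_Icc.2 zero_le_one
  obtain ⟨hac, hder⟩ := norm_sq_integral_absolutelyContinuous (h := fun t => h₁ t - h₂ t)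
    (x₀ := 0) ((hi₁ 1 h1).sub (hi₂ 1 h1)) fun t ht => by
      rw [heq₁ t ht, heq₂ t ht, add_sub_add_left_eq_sub, zero_add,
        intervalIntegral.integral_sub (hi₁ t ht) (hi₂ t ht)]
  have hzero := eq_zero_of_deriv_le_osgood (c := c₀ ^ 2) (a := a) (η := η)
    (pow_pos hc₀.1 2) (pow_le_one₀ hc₀.1.le hc₀.2.le) hac
    (by simp [heq₁ 0 (by simp), heq₂ 0 (by simp)]) (fun t _ => by positivity)
    (by
      filter_upwards [hder] with r hr hr01
      have hr' := Ioo_subset_Icc_self hr01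
      exact ⟨hr hr01, fun hlt => hF r hr' _ _ (hb₁ r hr') (hb₂ r hr')
        (lt_of_pow_lt_pow_left₀ 2 hc₀.1.le hlt)⟩)
    ha ha0 hη hη0 hηint
  intro t ht
  have := hzero t ht
  rwa [sq_eq_zero_iff, norm_eq_zero, sub_eq_zero] at this

end WellPosedness

section MatrixVector

variable {d m : ℕ}

theorem frobSq_nonneg (A : Matrix (Fin d) (Fin m) ℝ) : 0 ≤ frobSq A :=
  Finset.sum_nonneg fun _ _ => Finset.sum_nonneg fun _ _ => sq_nonneg _

theorem mVec_sub_left (A B : Matrix (Fin d) (Fin m) ℝ) (v : EuclideanSpace ℝ (Fin m)) :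
    mVec (A - B) v = mVec A v - mVec B v := by
  ext i
  simp [mVec, sub_mul, Finset.sum_sub_distrib]

theorem norm_mVec_le (A : Matrix (Fin d) (Fin m) ℝ) (v : EuclideanSpace ℝ (Fin m)) :
    ‖mVec A v‖ ≤ Real.sqrt (frobSq A) * ‖v‖ := by
  refine le_of_sq_le_sq ?_ (by positivity)
  rw [mul_pow, Real.sq_sqrt (frobSq_nonneg A), EuclideanSpace.real_norm_sq_eq,
    EuclideanSpace.real_norm_sq_eq, frobSq, Finset.sum_mul]
  exact Finset.sum_le_sum fun i _ => Finset.sum_mul_sq_le_sq_mul_sq Finset.univ (fun j => A i j)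
    fun j => v j

theorem inner_mVec (A : Matrix (Fin d) (Fin m) ℝ) (x : EuclideanSpace ℝ (Fin d))
    (v : EuclideanSpace ℝ (Fin m)) : ⟪x, mVec A v⟫ = ⟪mVecT A x, v⟫ := by
  simp only [PiLp.inner_apply, mVec, mVecT, WithLp.equiv_symm_apply, RCLike.inner_apply,
    conj_trivial, Finset.sum_mul, Finset.mul_sum]
  rw [Finset.sum_comm]
  exact Finset.sum_congr rfl fun _ _ => Finset.sum_congr rfl fun _ _ => by ring

/-- A bound on the drift pairing and on the transposed diffusion bounds the pairing with the
controlled vector field. -/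
theorem two_mul_inner_add_mVec_le {A : Matrix (Fin d) (Fin m) ℝ} {x y : EuclideanSpace ℝ (Fin d)}
    {C : ℝ} (h : max (frobSq A + 2 * ⟪x, y⟫) ‖mVecT A x‖ ≤ C) (v : EuclideanSpace ℝ (Fin m)) :
    2 * ⟪x, y + mVec A v⟫ ≤ C * (1 + 2 * ‖v‖) := by
  obtain ⟨h1, h2⟩ := max_le_iff.1 h
  have h3 := real_inner_le_norm (mVecT A x) v
  have h4 := mul_le_mul_of_nonneg_right h2 (norm_nonneg v)
  rw [inner_add_right, inner_mVec]
  linarith [frobSq_nonneg A]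

theorem aestronglyMeasurable_mVec {α : Type*} [MeasurableSpace α] {μ : Measure α}
    {A : α → Matrix (Fin d) (Fin m) ℝ} {v : α → EuclideanSpace ℝ (Fin m)}
    (hA : ∀ i j, AEStronglyMeasurable (fun s => A s i j) μ) (hv : AEStronglyMeasurable v μ) :
    AEStronglyMeasurable (fun s => mVec (A s) (v s)) μ := by
  have hvj : ∀ j, AEStronglyMeasurable (fun s => v s j) μ := fun j =>
    (EuclideanSpace.proj (𝕜 := ℝ) j).continuous.comp_aestronglyMeasurable hv
  refine (PiLp.continuous_toLp 2 _).comp_aestronglyMeasurable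
    (g := fun w : Fin d → ℝ => WithLp.toLp 2 w) (f := fun s i => ∑ j, A s i j * v s j) ?_
  refine (aemeasurable_pi_lambda _ fun i => ?_).aestronglyMeasurable
  exact (Finset.aestronglyMeasurable_fun_sum _ fun j _ => (hA i j).mul (hvj j)).aemeasurable

end MatrixVector

theorem memLp_two_of_nonneg_of_integrable_sq {α : Type*} [MeasurableSpace α] {μ : Measure α}
    {f : α → ℝ} (h0 : ∀ t, 0 ≤ f t) (hf : Integrable (fun t => f t ^ 2) μ) : MemLp f 2 μ := by
  have h1 : AEStronglyMeasurable f μ := by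
    have := Real.continuous_sqrt.comp_aestronglyMeasurable hf.aestronglyMeasurable
    simpa [Real.sqrt_sq, h0] using this
  exact (memLp_two_iff_integrable_sq h1).2 hf

theorem Adm.memLp_norm {m : ℕ} {l' : ℝ → EuclideanSpace ℝ (Fin m)} (hl : Adm l') :
    MemLp (fun t => ‖l' t‖) 2 (volume.restrict (Icc 0 1)) :=
  (memLp_two_iff_integrable_sq hl.1.norm).2 hl.2

theorem Adm.integrableOn_mul {m : ℕ} {l' : ℝ → EuclideanSpace ℝ (Fin m)} (hl : Adm l')
    {f : ℝ → ℝ} (h0 : ∀ t, 0 ≤ f t) (hf : IntegrableOn (fun t => f t ^ 2) (Icc 0 1)) (c : ℝ) :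
    IntegrableOn (fun t => f t * (1 + c * ‖l' t‖)) (Icc 0 1) := by
  have h1 : MemLp (fun t => 1 + c * ‖l' t‖) 2 (volume.restrict (Icc 0 1)) :=
    (memLp_const (1 : ℝ)).add (hl.memLp_norm.const_mul c)
  exact (memLp_two_of_nonneg_of_integrable_sq h0 hf).integrable_mul h1

theorem pos_of_monotoneOn_of_lintegral_eq_top {η : ℝ → ℝ} (hmono : MonotoneOn η (Ico 0 1))
    (hη0 : ∀ u ∈ Ico (0 : ℝ) 1, 0 ≤ η u)
    (hint : ∀ ε ∈ Ioo (0 : ℝ) 1, ∫⁻ u in Ioc (0 : ℝ) ε, ENNReal.ofReal (1 / η u) = ⊤) :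
    ∀ y ∈ Ioo (0 : ℝ) 1, 0 < η y := by
  intro y hy
  refine lt_of_le_of_ne (hη0 y (Ioo_subset_Ico_self hy)) fun h => ?_
  have h1 : ∫⁻ u in Ioc (0 : ℝ) y, ENNReal.ofReal (1 / η u) = ∫⁻ u in Ioc (0 : ℝ) y, 0 := by
    refine setLIntegral_congr_fun measurableSet_Ioc fun u hu => ?_
    have hu' : u ∈ Ico (0 : ℝ) 1 := ⟨hu.1.le, hu.2.trans_lt hy.2⟩
    have : η u = 0 := le_antisymm
      ((hmono hu' (Ioo_subset_Ico_self hy) hu.2).trans h.ge) (hη0 u hu')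
    simp [this]
  rw [hint y hy, lintegral_zero] at h1
  exact ENNReal.top_ne_zero h1

/-- existence and uniqueness of the controlled trajectory `F(l)`:
under the modulus-of-continuity, local integrability, local Osgood-type and
growth conditions, for every finite-energy control there is exactly one
solution of the controlled equation on `[0,1]`. -/
theorem controlled_equation_existence_uniqueness {d m : ℕ} (hd : 1 ≤ d) (hm : 1 ≤ m)
    (x₀ : EuclideanSpace ℝ (Fin d))
    (b : ℝ → EuclideanSpace ℝ (Fin d) → EuclideanSpace ℝ (Fin d))
    (σ : ℝ → EuclideanSpace ℝ (Fin d) → Matrix (Fin d) (Fin m) ℝ)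
    (hbmeas : Measurable (Function.uncurry b))
    (hσmeas : ∀ i j, Measurable fun p : ℝ × EuclideanSpace ℝ (Fin d) => σ p.1 p.2 i j)
    -- modulus-of-continuity condition
    (H G : ℝ → ℝ)
    (hH_cont : ContinuousOn H (Ici 0)) (hH_mono : MonotoneOn H (Ici 0))
    (hH0 : H 0 = 0) (hH_nonneg : ∀ u ∈ Ici (0:ℝ), 0 ≤ H u)
    (hG_nonneg : ∀ t, 0 ≤ G t)
    (hG_int : IntegrableOn (fun t => G t ^ 2) (Icc 0 1))
    (hmod : ∀ t ∈ Icc (0:ℝ) 1, ∀ x y,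
      Real.sqrt (frobSq (σ t x - σ t y)) + ‖b t x - b t y‖ ≤ G t * H ‖x - y‖)
    -- local integrability: ∫₀¹ sup_{|x| ≤ R} (|b(s,x)| + ‖σ(s,x)‖²) ds < ∞ for all R > 0
    (hloc : ∀ R > (0:ℝ), ∫⁻ s in Icc (0:ℝ) 1,
      ⨆ x ∈ Metric.closedBall (0 : EuclideanSpace ℝ (Fin d)) R,
        ENNReal.ofReal (‖b s x‖ + frobSq (σ s x)) < ⊤)
    -- local Osgood-type condition
    (c₀ : ℝ) (hc₀ : c₀ ∈ Ioo (0:ℝ) 1)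
    (hOsg : ∀ R > (0:ℝ), ∃ f η : ℝ → ℝ,
      (∀ t, 0 ≤ f t) ∧ IntegrableOn (fun t => f t ^ 2) (Icc 0 1) ∧
      DifferentiableOn ℝ η (Ico 0 1) ∧ η 0 = 0 ∧
      (∀ u ∈ Ico (0:ℝ) 1, 0 ≤ η u) ∧
      (∀ u ∈ Ico (0:ℝ) 1, 0 ≤ derivWithin η (Ico 0 1) u) ∧
      (∀ ε ∈ Ioo (0:ℝ) 1, ∫⁻ u in Ioc (0:ℝ) ε, ENNReal.ofReal (1 / η u) = ⊤) ∧
      (∀ t ∈ Icc (0:ℝ) 1, ∀ x y : EuclideanSpace ℝ (Fin d),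
        max ‖x‖ ‖y‖ ≤ R → ‖x - y‖ < c₀ →
        max (frobSq (σ t x - σ t y) + 2 * ⟪x - y, b t x - b t y⟫)
            ‖mVecT (σ t x - σ t y) (x - y)‖
          ≤ f t * η (‖x - y‖ ^ 2)))
    -- growth condition for |x| ≥ K
    (K : ℝ) (hK : 0 < K) (g γ : ℝ → ℝ)
    (hg_nonneg : ∀ t, 0 ≤ g t)
    (hg_int : IntegrableOn (fun t => g t ^ 2) (Icc 0 1))
    (hγ_diff : DifferentiableOn ℝ γ (Ici 0))
    (hγ_nonneg : ∀ u ∈ Ici (0:ℝ), 0 ≤ γ u)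
    (hγ_deriv : ∀ u ∈ Ici (0:ℝ), 0 ≤ derivWithin γ (Ici 0) u)
    (hγ_top : Filter.Tendsto γ Filter.atTop Filter.atTop)
    (hγ_int : ∫⁻ s in Ioi K, ENNReal.ofReal (1 / (γ s + 1)) = ⊤)
    (hgrowth : ∀ t ∈ Icc (0:ℝ) 1, ∀ x : EuclideanSpace ℝ (Fin d), K ≤ ‖x‖ →
      max (frobSq (σ t x) + 2 * ⟪x, b t x⟫) ‖mVecT (σ t x) x‖
        ≤ g t * (γ (‖x‖ ^ 2) + 1))
    :
    ∀ l' : ℝ → EuclideanSpace ℝ (Fin m), Adm l' →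
      ∃ h : ℝ → EuclideanSpace ℝ (Fin d), IsSol b σ x₀ l' h ∧
        ∀ h₂ : ℝ → EuclideanSpace ℝ (Fin d), IsSol b σ x₀ l' h₂ →
          ∀ t ∈ Icc (0:ℝ) 1, h₂ t = h t := by
  intro l' hl
  set F : ℝ → EuclideanSpace ℝ (Fin d) → EuclideanSpace ℝ (Fin d) :=
    fun s x => b s x + mVec (σ s x) (l' s) with hF
  have hFsub : ∀ s x y, F s x - F s y = (b s x - b s y) + mVec (σ s x - σ s y) (l' s) :=
    fun s x y => by
      simp only [hF, mVec_sub_left]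
      abel
  have hFdiff : ∀ s ∈ Icc (0 : ℝ) 1, ∀ x y,
      ‖F s x - F s y‖ ≤ G s * (1 + 1 * ‖l' s‖) * H ‖x - y‖ := by
    intro s hs x y
    have h1 := hmod s hs x y
    have h2 := norm_mVec_le (σ s x - σ s y) (l' s)
    have h3 := mul_le_mul_of_nonneg_right
      ((le_add_of_nonneg_right (norm_nonneg _)).trans h1) (norm_nonneg (l' s))
    rw [hFsub]
    refine (norm_add_le _ _).trans ?_
    linarith [Real.sqrt_nonneg (frobSq (σ s x - σ s y))]
  have hFc : ∀ s ∈ Icc (0 : ℝ) 1, Continuous (F s) := by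
    intro s hs
    rw [continuous_iff_continuousAt]
    intro y
    refine tendsto_iff_norm_sub_tendsto_zero.2
      (squeeze_zero (fun _ => norm_nonneg _) (fun x => hFdiff s hs x y) ?_)
    have h1 : Filter.Tendsto (fun x => ‖x - y‖) (nhds y) (nhdsWithin 0 (Ici 0)) := by
      refine tendsto_nhdsWithin_iff.2 ⟨?_, Filter.Eventually.of_forall fun x => norm_nonneg _⟩
      exact tendsto_iff_norm_sub_tendsto_zero.1 Filter.tendsto_id
    have h2 : Filter.Tendsto H (nhdsWithin 0 (Ici 0)) (nhds 0) := by
      simpa [ContinuousWithinAt, hH0] using hH_cont 0 self_mem_Ici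
    simpa using (h2.comp h1).const_mul (G s * (1 + 1 * ‖l' s‖))
  have hFm : ∀ h : ℝ → EuclideanSpace ℝ (Fin d), Continuous h →
      AEStronglyMeasurable (fun s => F s (h s)) (volume.restrict (Icc 0 1)) := by
    intro h hh
    have hp : Measurable fun s : ℝ => (s, h s) := measurable_id.prodMk hh.measurable
    exact (hbmeas.comp hp).aestronglyMeasurable.add (aestronglyMeasurable_mVec
      (fun i j => ((hσmeas i j).comp hp).aestronglyMeasurable) hl.1)
  have hF0 : IntegrableOn (fun s => ‖F s 0‖) (Icc 0 1) := by
    have hp : Measurable fun s : ℝ => (s, (0 : EuclideanSpace ℝ (Fin d))) :=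
      measurable_id.prodMk measurable_const
    have hbm : Measurable fun s => b s 0 := hbmeas.comp hp
    have hσm : Measurable fun s => frobSq (σ s 0) := by
      unfold frobSq
      exact Finset.measurable_fun_sum _ fun i _ => Finset.measurable_fun_sum _ fun j _ =>
        ((hσmeas i j).comp hp).pow_const 2
    have hsum : IntegrableOn (fun s => ‖b s 0‖ + frobSq (σ s 0)) (Icc 0 1) := by
      refine ⟨(hbm.norm.add hσm).aestronglyMeasurable, ?_⟩
      rw [hasFiniteIntegral_iff_ofReal (Filter.Eventually.of_forall fun s =>
        add_nonneg (norm_nonneg _) (frobSq_nonneg _))]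
      refine lt_of_le_of_lt (lintegral_mono fun s => ?_) (hloc 1 one_pos)
      exact le_iSup₂_of_le (0 : EuclideanSpace ℝ (Fin d)) (by simp) le_rfl
    have hσi : IntegrableOn (fun s => Real.sqrt (frobSq (σ s 0)) ^ 2) (Icc 0 1) := by
      simp only [Real.sq_sqrt (frobSq_nonneg _)]
      refine Integrable.mono' hsum hσm.aestronglyMeasurable
        (Filter.Eventually.of_forall fun s => ?_)
      rw [Real.norm_of_nonneg (frobSq_nonneg _)]
      exact le_add_of_nonneg_left (norm_nonneg _)
    refine Integrable.mono' (hsum.add (hl.integrableOn_mul (fun _ => Real.sqrt_nonneg _) hσi 1))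
      (hFm _ continuous_const).norm (Filter.Eventually.of_forall fun s => ?_)
    rw [norm_norm]
    refine (norm_add_le _ _).trans ?_
    have h1 := norm_mVec_le (σ s 0) (l' s)
    simp only [Pi.add_apply]
    linarith [Real.sqrt_nonneg (frobSq (σ s 0)), frobSq_nonneg (σ s 0)]
  have hM : ∀ R : ℝ, 0 < R → ∃ M : ℝ → ℝ, IntegrableOn M (Icc 0 1) ∧
      ∀ s ∈ Icc (0 : ℝ) 1, ∀ x, ‖x‖ ≤ R → ‖F s x‖ ≤ M s := by
    intro R hR
    refine ⟨fun s => ‖F s 0‖ + G s * (1 + 1 * ‖l' s‖) * H R,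
      hF0.add ((hl.integrableOn_mul hG_nonneg hG_int 1).mul_const _), fun s hs x hx => ?_⟩
    have h1 := hFdiff s hs x 0
    rw [sub_zero] at h1
    have h2 : H ‖x‖ ≤ H R := hH_mono (norm_nonneg x) hR.le hx
    have h3 : 0 ≤ G s * (1 + 1 * ‖l' s‖) := mul_nonneg (hG_nonneg s) (by positivity)
    have h4 := norm_le_insert' (F s x) (F s 0)
    linarith [mul_le_mul_of_nonneg_left h2 h3]
  have hInterval : ∀ f : ℝ → ℝ, (∀ t, 0 ≤ f t) → IntegrableOn (fun t => f t ^ 2) (Icc 0 1) →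
      IntervalIntegrable (fun t => f t * (1 + 2 * ‖l' t‖)) volume 0 1 := fun f h0 hf =>
    IntegrableOn.intervalIntegrable (by
      rw [uIcc_of_le zero_le_one]
      exact hl.integrableOn_mul h0 hf 2)
  obtain ⟨h, hc, heq⟩ := exists_eq_integral_of_inner_le hFc hFm hM
    (a := fun t => g t * (1 + 2 * ‖l' t‖)) (ψ := fun y => γ y + 1) hK
    (hInterval g hg_nonneg hg_int) (fun t => mul_nonneg (hg_nonneg t) (by positivity))
    (hγ_diff.continuousOn.add continuousOn_const)
    (fun y hy => by linarith [hγ_nonneg y hy]) hγ_int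
    (fun s hs x hx => (two_mul_inner_add_mVec_le (hgrowth s hs x hx) (l' s)).trans_eq (by ring)) x₀
  refine ⟨h, ⟨hc.continuousOn, heq⟩, fun h₂ hh₂ => ?_⟩
  refine eqOn_of_eq_integral_of_osgood hFm hM hc₀ (fun R hR => ?_) hh₂.1 hc.continuousOn hh₂.2 heq
  obtain ⟨f, η, hf0, hf, hηd, -, hη0, hη', hηint, hfη⟩ := hOsg R hR
  have hmono : MonotoneOn η (Ico 0 1) := by
    refine monotoneOn_of_deriv_nonneg (convex_Ico 0 1) hηd.continuousOn
      (hηd.mono interior_subset) fun u hu => ?_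
    rw [← derivWithin_of_mem_nhds (mem_interior_iff_mem_nhds.1 hu)]
    exact hη' u (interior_subset hu)
  refine ⟨fun t => f t * (1 + 2 * ‖l' t‖), η, fun t => mul_nonneg (hf0 t) (by positivity),
    hInterval f hf0 hf, hηd.continuousOn, pos_of_monotoneOn_of_lintegral_eq_top hmono hη0 hηint,
    hηint, fun s hs x y hx hy hxy => ?_⟩
  rw [hFsub]
  exact (two_mul_inner_add_mVec_le (hfη s hs x y (max_le hx hy) hxy) (l' s)).trans_eq (by ring)
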